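/- arXiv:2107.13495 — 3 statements merged into one kernel-verified Lean document; each statement's English description precedes it below -/
import Mathlib

section
/- The number of connected graphs on vertex set {1,...,n} satisfying the interval-clique property equals the (n-1)-th Catalan number C_{n-1} = (1/n) · C(2n-2, n-1). -/
/-- Interval-clique property: whenever `i < j` are adjacent, `{i,...,j}` is a clique. -/
def IntervalClique {n : ℕ} (G : SimpleGraph (Fin n)) : Prop :=
  ∀ i j k l : Fin n, i < j → G.Adj i j → i ≤ k → k ≤ j → i ≤ l → l ≤ j → k ≠ l → G.Adj k l

/-- The functions counted by the Catalan number of `m`: monotone maps `g` with `i ≤ g i < m` for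
`i < m`, extended by the identity beyond `m`. -/
structure IsDyckFunction (m : ℕ) (g : ℕ → ℕ) : Prop where
  mono : Monotone g
  le_apply : ∀ i, i ≤ g i
  apply_lt : ∀ i, i < m → g i < m
  apply_eq : ∀ i, m ≤ i → g i = i

/-- Dyck functions of size `i` and `m - i` glued along a first fixed point at `i`. -/
def glueDyck (i : ℕ) (a b : ℕ → ℕ) (j : ℕ) : ℕ :=
  if j < i then a j + 1 else if j = i then i else b (j - (i + 1)) + (i + 1)

/-- The part of a function before its fixed point `i`, lowered by one. -/
def dyckBefore (i : ℕ) (g : ℕ → ℕ) (j : ℕ) : ℕ := if j < i then g j - 1 else j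

/-- The part of a function after its fixed point `i`, translated to the origin. -/
def dyckAfter (i : ℕ) (g : ℕ → ℕ) (j : ℕ) : ℕ := g (j + (i + 1)) - (i + 1)

theorem IsDyckFunction.glue {m i : ℕ} {a b : ℕ → ℕ} (hi : i ≤ m) (ha : IsDyckFunction i a)
    (hb : IsDyckFunction (m - i) b) : IsDyckFunction (m + 1) (glueDyck i a b) where
  mono := by
    intro j k hjk
    have h1 := ha.mono hjk
    have h2 := ha.apply_lt j
    have h3 := hb.mono (show j - (i + 1) ≤ k - (i + 1) by omega)
    unfold glueDyck
    split_ifs <;> omega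
  le_apply j := by
    have h1 := ha.le_apply j
    have h2 := hb.le_apply (j - (i + 1))
    unfold glueDyck
    split_ifs <;> omega
  apply_lt j hj := by
    have h1 := ha.apply_lt j
    have h2 := hb.apply_lt (j - (i + 1))
    unfold glueDyck
    split_ifs <;> omega
  apply_eq j hj := by
    have h2 := hb.apply_eq (j - (i + 1))
    unfold glueDyck
    split_ifs <;> omega

theorem IsDyckFunction.before {m i : ℕ} {g : ℕ → ℕ} (hg : IsDyckFunction m g)
    (hi : g i = i) (hlt : ∀ j < i, j < g j) : IsDyckFunction i (dyckBefore i g) where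
  mono := by
    intro j k hjk
    have h1 := hg.mono hjk
    have h2 := hlt k
    have h3 : j ≤ i → g j ≤ g i := fun h => hg.mono h
    unfold dyckBefore
    split_ifs <;> omega
  le_apply j := by
    have h1 := hlt j
    unfold dyckBefore
    split_ifs <;> omega
  apply_lt j hj := by
    have h1 := hlt j
    have h3 := hg.mono hj.le
    unfold dyckBefore
    split_ifs; omega
  apply_eq j hj := by
    unfold dyckBefore
    split_ifs <;> omega

theorem IsDyckFunction.after {m i : ℕ} {g : ℕ → ℕ} (hg : IsDyckFunction (m + 1) g) :
    IsDyckFunction (m - i) (dyckAfter i g) where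
  mono := by
    intro j k hjk
    have h1 := hg.mono (show j + (i + 1) ≤ k + (i + 1) by omega)
    unfold dyckAfter
    omega
  le_apply j := by
    have h1 := hg.le_apply (j + (i + 1))
    unfold dyckAfter
    omega
  apply_lt j hj := by
    have h1 := hg.apply_lt (j + (i + 1))
    unfold dyckAfter
    omega
  apply_eq j hj := by
    have h1 := hg.apply_eq (j + (i + 1))
    unfold dyckAfter
    omega

theorem IsDyckFunction.glue_before_after {m i : ℕ} {g : ℕ → ℕ} (hg : IsDyckFunction m g)
    (hi : g i = i) (hlt : ∀ j < i, j < g j) :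
    glueDyck i (dyckBefore i g) (dyckAfter i g) = g := by
  funext j
  unfold glueDyck
  split_ifs with h1 h2
  · have := hlt j h1
    simp only [dyckBefore, if_pos h1]
    omega
  · rw [h2, hi]
  · have h3 : j - (i + 1) + (i + 1) = j := by omega
    have h4 := hg.le_apply j
    simp only [dyckAfter, h3]
    omega

theorem IsDyckFunction.dyckBefore_glueDyck {i : ℕ} {a b : ℕ → ℕ} (ha : IsDyckFunction i a) :
    dyckBefore i (glueDyck i a b) = a := by
  funext j
  by_cases h : j < i
  · simp [dyckBefore, glueDyck, h]
  · simp [dyckBefore, h, ha.apply_eq j (by omega)]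

theorem dyckAfter_glueDyck (i : ℕ) (a b : ℕ → ℕ) : dyckAfter i (glueDyck i a b) = b := by
  funext j
  simp only [dyckAfter, glueDyck]
  rw [if_neg (by omega), if_neg (by omega)]
  simp

theorem glueDyck_apply_self (i : ℕ) (a b : ℕ → ℕ) : glueDyck i a b i = i := by
  simp [glueDyck]

theorem IsDyckFunction.lt_glueDyck {i j : ℕ} {a b : ℕ → ℕ} (ha : IsDyckFunction i a)
    (hj : j < i) : j < glueDyck i a b j := by
  have := ha.le_apply j
  simp only [glueDyck, if_pos hj]
  omega

/-- Gluing Dyck functions, as a map from pairs with total size `m` to size `m + 1`. -/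
def glueDyckSigma (m : ℕ)
    (x : Σ i : Fin (m + 1), {a // IsDyckFunction i a} × {b // IsDyckFunction (m - i) b}) :
    {g // IsDyckFunction (m + 1) g} :=
  ⟨glueDyck x.1 x.2.1 x.2.2, .glue (Nat.le_of_lt_succ x.1.2) x.2.1.2 x.2.2.2⟩

theorem glueDyckSigma_bijective (m : ℕ) : Function.Bijective (glueDyckSigma m) := by
  constructor
  · rintro ⟨i, ⟨a, ha⟩, ⟨b, hb⟩⟩ ⟨i', ⟨a', ha'⟩, ⟨b', hb'⟩⟩ h
    have h : glueDyck i a b = glueDyck i' a' b' := congrArg Subtype.val h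
    have hii : i = i' := by
      rcases lt_trichotomy (i : ℕ) i' with hlt | heq | hlt
      · have := ha'.lt_glueDyck (b := b') hlt
        rw [← h, glueDyck_apply_self] at this
        omega
      · exact Fin.ext heq
      · have := ha.lt_glueDyck (b := b) hlt
        rw [h, glueDyck_apply_self] at this
        omega
    subst hii
    have h1 : a = a' := by
      rw [← ha.dyckBefore_glueDyck (b := b), h, ha'.dyckBefore_glueDyck]
    have h2 : b = b' := by
      rw [← dyckAfter_glueDyck i a b, h, dyckAfter_glueDyck]
    subst h1 h2
    rfl
  · rintro ⟨g, hg⟩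
    have hm : g m = m := by
      have h1 := hg.le_apply m
      have h2 := hg.apply_lt m
      omega
    have hex : ∃ i, g i = i := ⟨m, hm⟩
    have hi := Nat.find_spec hex
    have hlt : ∀ j < Nat.find hex, j < g j := fun j hj =>
      lt_of_le_of_ne (hg.le_apply j) (Ne.symm (Nat.find_min hex hj))
    refine ⟨⟨⟨Nat.find hex, Nat.lt_succ_of_le (Nat.find_le hm)⟩,
      ⟨_, hg.before hi hlt⟩, ⟨_, hg.after⟩⟩, Subtype.ext (hg.glue_before_after hi hlt)⟩

theorem isDyckFunction_zero_iff {g : ℕ → ℕ} : IsDyckFunction 0 g ↔ g = id :=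
  ⟨fun h => funext fun i => h.apply_eq i i.zero_le, by
    rintro rfl
    exact ⟨monotone_id, fun _ => le_rfl, fun _ h => h, fun _ _ => rfl⟩⟩

theorem finite_and_card_isDyckFunction (m : ℕ) :
    Finite {g // IsDyckFunction m g} ∧ Nat.card {g // IsDyckFunction m g} = catalan m := by
  induction m using Nat.strong_induction_on with
  | _ m ih =>
    cases m with
    | zero =>
      simp only [isDyckFunction_zero_iff]
      exact ⟨inferInstance, by simp⟩
    | succ m =>
      have h1 (i : Fin (m + 1)) := ih i i.2
      have h2 (i : Fin (m + 1)) := ih (m - i) (by omega)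
      have hf1 (i : Fin (m + 1)) := (h1 i).1
      have hf2 (i : Fin (m + 1)) := (h2 i).1
      refine ⟨.of_surjective _ (glueDyckSigma_bijective m).2, ?_⟩
      rw [← Nat.card_eq_of_bijective _ (glueDyckSigma_bijective m), Nat.card_sigma, catalan_succ]
      exact Finset.sum_congr rfl fun i _ => by rw [Nat.card_prod, (h1 i).2, (h2 i).2]

/-- The graph in which `i < j` are adjacent when `j ≤ g i + 1`. -/
def dyckGraph (m : ℕ) (g : ℕ → ℕ) : SimpleGraph (Fin (m + 1)) where
  Adj i j := (i < j ∧ (j : ℕ) ≤ g i + 1) ∨ (j < i ∧ (i : ℕ) ≤ g j + 1)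
  symm := ⟨fun _ _ h => h.symm⟩
  loopless := ⟨fun i h => by simp at h⟩

theorem dyckGraph_adj_of_lt {m : ℕ} {g : ℕ → ℕ} {i j : Fin (m + 1)} (h : i < j) :
    (dyckGraph m g).Adj i j ↔ (j : ℕ) ≤ g i + 1 := by
  simp [dyckGraph, h, h.not_gt]

theorem IsDyckFunction.intervalClique {m : ℕ} {g : ℕ → ℕ} (hg : IsDyckFunction m g) :
    IntervalClique (dyckGraph m g) := by
  intro i j k l hij hadj hik hkj hil hlj hkl
  rw [dyckGraph_adj_of_lt hij] at hadj
  have h1 := hg.mono (show (i : ℕ) ≤ k from hik)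
  have h2 := hg.mono (show (i : ℕ) ≤ l from hil)
  rw [Fin.le_def] at hkj hlj
  rcases lt_or_gt_of_ne hkl with h | h
  · rw [dyckGraph_adj_of_lt h]
    omega
  · rw [SimpleGraph.adj_comm, dyckGraph_adj_of_lt h]
    omega

theorem IsDyckFunction.connected {m : ℕ} {g : ℕ → ℕ} (hg : IsDyckFunction m g) :
    (dyckGraph m g).Connected := by
  have key (i : ℕ) (hi : i < m + 1) : (dyckGraph m g).Reachable 0 ⟨i, hi⟩ := by
    induction i with
    | zero => exact .rfl
    | succ i ih =>
      refine (ih (by omega)).trans (SimpleGraph.Adj.reachable ?_)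
      rw [dyckGraph_adj_of_lt (by simp [Fin.lt_def])]
      simpa using hg.le_apply i
  exact (SimpleGraph.connected_iff _).2 ⟨fun a b => (key a a.2).symm.trans (key b b.2), ⟨0⟩⟩

theorem IsDyckFunction.le_of_dyckGraph_eq {m : ℕ} {g g' : ℕ → ℕ} (hg : IsDyckFunction m g)
    (hg' : IsDyckFunction m g') (h : dyckGraph m g = dyckGraph m g') : g ≤ g' := by
  intro i
  by_cases hi : i < m
  · have h1 := hg.apply_lt i hi
    have h2 := hg.le_apply i
    have hlt : (⟨i, by omega⟩ : Fin (m + 1)) < ⟨g i + 1, by omega⟩ := by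
      rw [Fin.lt_def]
      simp only
      omega
    have h3 := (dyckGraph_adj_of_lt (g := g) hlt).2 le_rfl
    rw [h, dyckGraph_adj_of_lt hlt] at h3
    simpa using h3
  · rw [hg.apply_eq i (by omega), hg'.apply_eq i (by omega)]

theorem IntervalClique.adj_succ {m : ℕ} {G : SimpleGraph (Fin (m + 1))} (hG : IntervalClique G)
    (hc : G.Connected) (i : ℕ) (hi : i < m) :
    G.Adj ⟨i, by omega⟩ ⟨i + 1, by omega⟩ := by
  obtain ⟨p⟩ := hc.preconnected (⟨i, by omega⟩ : Fin (m + 1)) ⟨i + 1, by omega⟩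
  obtain ⟨d, -, h1, h2⟩ := p.exists_boundary_dart {v | (v : ℕ) ≤ i} (by simp) (by simp)
  simp only [Set.mem_ofPred_eq] at h1 h2
  refine hG d.fst d.snd _ _ ?_ d.adj ?_ ?_ ?_ ?_ ?_ <;>
    simp only [Fin.lt_def, Fin.le_def, ne_eq, Fin.mk.injEq] <;> omega

open Classical in
theorem IntervalClique.exists_dyckGraph_eq {m : ℕ} {G : SimpleGraph (Fin (m + 1))}
    (hG : IntervalClique G) (hc : G.Connected) : ∃ g, IsDyckFunction m g ∧ dyckGraph m g = G := by
  let P (i j : ℕ) : Prop := ∃ (hi : i < m + 1) (hj : j + 1 < m + 1), G.Adj ⟨i, hi⟩ ⟨j + 1, hj⟩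
  let g (i : ℕ) : ℕ := if i < m then Nat.findGreatest (P i) m else i
  have hP (i : ℕ) (hi : i < m) : P i i := ⟨by omega, by omega, hG.adj_succ hc i hi⟩
  have hgP (i : ℕ) (hi : i < m) : P i (g i) := by
    simp only [g, if_pos hi]
    exact Nat.findGreatest_spec hi.le (hP i hi)
  have hle (i j : ℕ) (hi : i < m) (hj : P i j) : j ≤ g i := by
    obtain ⟨_, hjm, -⟩ := id hj
    simp only [g, if_pos hi]
    exact Nat.le_findGreatest (by omega) hj
  have hself (i : ℕ) : i ≤ g i := by
    by_cases hi : i < m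
    · exact hle i i hi (hP i hi)
    · simp [g, hi]
  have hlt (i : ℕ) (hi : i < m) : g i < m := by
    obtain ⟨_, h, -⟩ := hgP i hi
    omega
  have hshrink (i k l j : ℕ) (hik : i ≤ k) (hkl : k ≤ l) (hlj : l ≤ j) (h : P i j) : P k l := by
    obtain ⟨h1, h2, h3⟩ := h
    refine ⟨by omega, by omega, hG _ _ _ _ ?_ h3 ?_ ?_ ?_ ?_ ?_⟩ <;>
      simp only [Fin.lt_def, Fin.le_def, ne_eq, Fin.mk.injEq] <;> omega
  refine ⟨g, ⟨fun i k hik => ?_, hself, hlt, fun i hi => by simp [g, hi]⟩, ?_⟩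
  · by_cases hk : k < m
    · by_cases hgk : g i < k
      · exact hgk.le.trans (hself k)
      · exact hle k _ hk
          (hshrink i k _ _ hik (not_lt.1 hgk) le_rfl (hgP i (lt_of_le_of_lt hik hk)))
    · have h1 := hself k
      by_cases hi : i < m
      · have := hlt i hi
        omega
      · simpa [g, hi, hk] using hik
  · have key (i j : Fin (m + 1)) (hij : i < j) : (dyckGraph m g).Adj i j ↔ G.Adj i j := by
      rw [dyckGraph_adj_of_lt hij]
      obtain ⟨i, hi⟩ := i
      obtain ⟨_ | j, hj⟩ := j
      · simp at hij
      · simp only [Fin.lt_def] at hij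
        have him : i < m := by omega
        simp only [add_le_add_iff_right]
        constructor
        · intro h
          obtain ⟨_, _, h⟩ := hshrink i i j _ le_rfl (by omega) h (hgP i him)
          exact h
        · exact fun h => hle i j him ⟨hi, hj, h⟩
    ext i j
    rcases lt_trichotomy i j with h | rfl | h
    · exact key i j h
    · simp
    · rw [SimpleGraph.adj_comm, key j i h, SimpleGraph.adj_comm]

/-- the number of connected interval-clique graphs on `{1,...,n}` is the
`(n-1)`-th Catalan number `C_{n-1} = (1/n)·C(2n-2,n-1)`. -/
theorem card_connected_intervalClique_graphs (n : ℕ) (hn : 1 ≤ n) :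
    Nat.card {G : SimpleGraph (Fin n) // IntervalClique G ∧ G.Connected} = catalan (n - 1) := by
  obtain ⟨m, rfl⟩ := Nat.exists_eq_add_of_le' hn
  rw [Nat.add_sub_cancel, ← (finite_and_card_isDyckFunction m).2]
  let F (g : {g // IsDyckFunction m g}) :
      {G : SimpleGraph (Fin (m + 1)) // IntervalClique G ∧ G.Connected} :=
    ⟨dyckGraph m g, g.2.intervalClique, g.2.connected⟩
  refine (Nat.card_eq_of_bijective F ⟨fun g g' h => ?_, fun G => ?_⟩).symm
  · have h : dyckGraph m g = dyckGraph m g' := congrArg Subtype.val h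
    exact Subtype.ext (le_antisymm (g.2.le_of_dyckGraph_eq g'.2 h)
      (g'.2.le_of_dyckGraph_eq g.2 h.symm))
  · obtain ⟨g, hg, h⟩ := G.2.1.exists_dyckGraph_eq G.2.2
    exact ⟨⟨g, hg⟩, Subtype.ext h⟩
end

section
/- Let S be a connected structure (isomorphism class of connected graphs) of the 1D RGG model. Then the number of ordered geometric graphs representing S is 1 if S admits a left-right symmetric representative, and 2 otherwise; in particular 1 ≤ |f̂⁻¹(S)| ≤ 2. -/
namespace IntervalClique

variable {n : ℕ} {G G' : SimpleGraph (Fin n)}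

/-- The left-right reversal of a graph on `Fin n`. -/
def reversal (G : SimpleGraph (Fin n)) : SimpleGraph (Fin n) := G.comap Fin.rev

theorem reversal_adj (i j : Fin n) : (reversal G).Adj i j ↔ G.Adj i.rev j.rev := Iff.rfl

theorem reversal_eq_iff : reversal G = G ↔ ∀ i j : Fin n, G.Adj i j ↔ G.Adj i.rev j.rev := by
  constructor
  · intro h i j
    rw [← reversal_adj, h]
  · intro h
    ext i j
    rw [reversal_adj, ← h]

/-- A graph is isomorphic to its reversal. -/
def reversalIso (G : SimpleGraph (Fin n)) : reversal G ≃g G :=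
  SimpleGraph.Iso.comap Fin.revPerm G

theorem adj_of_le (hG : IntervalClique G) {i j k l : Fin n} (h : G.Adj i j) (hik : i ≤ k)
    (hkl : k < l) (hlj : l ≤ j) : G.Adj k l :=
  hG i j k l (by lia) h hik (by lia) (by lia) hlj hkl.ne

theorem intervalClique_reversal (hG : IntervalClique G) : IntervalClique (reversal G) := by
  intro i j k l hij h hik hkj hil hlj hkl
  exact hG j.rev i.rev k.rev l.rev (Fin.rev_lt_rev.2 hij) h.symm (Fin.rev_le_rev.2 hkj)
    (Fin.rev_le_rev.2 hik) (Fin.rev_le_rev.2 hlj) (Fin.rev_le_rev.2 hil)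
    (fun e => hkl (Fin.rev_injective e))

/-- Consecutive vertices of a connected ordered geometric graph are adjacent. -/
theorem adj_succ_s14 (hG : IntervalClique G) (hc : G.Connected) {i j : Fin n}
    (hij : i.val + 1 = j.val) : G.Adj i j := by
  obtain ⟨p⟩ := hc.preconnected i j
  obtain ⟨d, -, hd₁, hd₂⟩ := p.exists_boundary_dart (Set.Iic i) (by simp) (by simp; lia)
  simp only [Set.mem_Iic, not_le] at hd₁ hd₂
  exact hG.adj_of_le d.adj hd₁ (by lia) (by lia)

/-- Adjacent vertices which are both non-adjacent to `a` lie on the same side of `a` in every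
ordered geometric graph. -/
theorem lt_iff_lt_of_adj (hG' : IntervalClique G') (π : G ≃g G') {a b c : Fin n}
    (hb : ¬ G.Adj a b) (hc : ¬ G.Adj a c) (hab : a ≠ b) (hac : a ≠ c) (hbc : G.Adj b c) :
    π a < π b ↔ π a < π c := by
  rw [← π.map_adj_iff] at hb hc hbc
  have hab' : π a ≠ π b := π.injective.ne hab
  have hac' : π a ≠ π c := π.injective.ne hac
  constructor
  · intro h
    by_contra! h'
    exact hb (hG'.adj_of_le hbc.symm h' h le_rfl)
  · intro h
    by_contra! h'
    exact hc (hG'.adj_of_le hbc h' h le_rfl)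

theorem lt_iff_lt_of_le_right (hG : IntervalClique G) (hc : G.Connected)
    (hG' : IntervalClique G') (π : G ≃g G') {a b c : Fin n} (hab : a < b) (h : ¬ G.Adj a b)
    (hbc : b ≤ c) : π a < π b ↔ π a < π c := by
  obtain ⟨c, hcn⟩ := c
  replace hbc : b.val ≤ c := hbc
  induction c, hbc using Nat.le_induction with
  | base => rfl
  | succ c hbc ih =>
    have far (d : Fin n) (hd : b ≤ d) : ¬ G.Adj a d := fun h' => h (hG.adj_of_le h' le_rfl hab hd)
    refine (ih (Nat.lt_of_succ_lt hcn)).trans ?_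
    exact hG'.lt_iff_lt_of_adj π (far _ hbc) (far _ (Nat.le_succ_of_le hbc))
      (by simp [Fin.ext_iff]; lia) (by simp [Fin.ext_iff]; lia) (hG.adj_succ_s14 hc rfl)

theorem reversal_connected (hc : G.Connected) : (reversal G).Connected :=
  (reversalIso G).connected_iff.2 hc

theorem lt_iff_lt_of_le_left (hG : IntervalClique G) (hc : G.Connected)
    (hG' : IntervalClique G') (π : G ≃g G') {a b c : Fin n} (hab : a < b) (h : ¬ G.Adj a b)
    (hca : c ≤ a) : π a < π b ↔ π c < π b := by
  have key := hG.intervalClique_reversal.lt_iff_lt_of_le_right (reversal_connected hc) hG'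
    ((reversalIso G).trans π) (Fin.rev_lt_rev.2 hab)
    (by simpa [reversal_adj, G.adj_comm] using h) (Fin.rev_le_rev.2 hca)
  have ev (x : Fin n) : ((reversalIso G).trans π) x.rev = π x := congrArg π (Fin.rev_rev x)
  rw [ev, ev, ev] at key
  have h₁ : π a ≠ π b := π.injective.ne hab.ne
  have h₂ : π c ≠ π b := π.injective.ne (hca.trans_lt hab).ne
  lia

/-- Some `k ≤ i` is moved weakly above `i` by a permutation of `Fin n`. -/
theorem exists_le_and_le_apply (π : Equiv.Perm (Fin n)) (i : Fin n) : ∃ k ≤ i, i ≤ π k := by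
  by_contra! h
  have := Finset.card_le_card_of_injOn (s := Finset.Iic i) (t := Finset.Iio i) π
    (fun k hk => by simpa using h k (by simpa using hk)) π.injective.injOn
  simp at this

theorem exists_ge_and_apply_le (π : Equiv.Perm (Fin n)) (i : Fin n) : ∃ k, i ≤ k ∧ π k ≤ i := by
  obtain ⟨k, hk, hk'⟩ := exists_le_and_le_apply π.symm i
  exact ⟨π.symm k, hk', by simpa using hk⟩

theorem le_of_iso (hG : IntervalClique G) (hG' : IntervalClique G') (π : G ≃g G')
    (hπ : ∀ i j, i < j → ¬ G.Adj i j → π i < π j) : G' ≤ G := by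
  have main (i j : Fin n) (hij : i < j) (h : G'.Adj i j) : G.Adj i j := by
    by_contra hn
    obtain ⟨k, hk, hk'⟩ := exists_le_and_le_apply π.toEquiv i
    obtain ⟨m, hm, hm'⟩ := exists_ge_and_apply_le π.toEquiv j
    have hkm : ¬ G.Adj k m := fun h' => hn (hG.adj_of_le h' hk hij hm)
    exact hkm (π.map_adj_iff.1 (hG'.adj_of_le h hk' (hπ k m (by lia) hkm) hm'))
  intro i j h
  rcases h.ne.lt_or_gt with hij | hij
  · exact main i j hij h
  · exact (main j i hij h.symm).symm

/-- Ordered geometric graphs related by an isomorphism which keeps the order of non-adjacent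
vertices are equal. -/
theorem eq_of_iso (hG : IntervalClique G) (hG' : IntervalClique G') (π : G ≃g G')
    (hπ : ∀ i j, i < j → ¬ G.Adj i j → π i < π j) : G' = G := by
  refine le_antisymm (hG.le_of_iso hG' π hπ) (hG'.le_of_iso hG π.symm fun i j hij h => ?_)
  by_contra! hle
  have hne : π.symm j ≠ π.symm i := π.symm.injective.ne hij.ne'
  have := hπ _ _ (hle.lt_of_ne hne) (by rwa [π.symm.map_adj_iff, G'.adj_comm])
  simp only [RelIso.apply_symm_apply] at this
  exact this.not_gt hij

/-- A connected ordered geometric graph determines every isomorphic one up to reversal. -/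
theorem eq_or_eq_reversal (hG : IntervalClique G) (hc : G.Connected)
    (hG' : IntervalClique G') (π : G ≃g G') : G' = G ∨ G' = reversal G := by
  obtain ⟨v⟩ := hc.nonempty
  have : NeZero n := ⟨by have := v.isLt; lia⟩
  have key (a b : Fin n) (hab : a < b) (h : ¬ G.Adj a b) : π a < π b ↔ π 0 < π (Fin.rev 0) := by
    have hb : b ≤ Fin.rev 0 := by rw [Fin.le_def, Fin.val_rev, Fin.val_zero]; lia
    rw [hG.lt_iff_lt_of_le_right hc hG' π hab h hb]
    exact hG.lt_iff_lt_of_le_left hc hG' π (hab.trans_le hb)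
      (fun h' => h (hG.adj_of_le h' le_rfl hab hb)) (Fin.zero_le a)
  by_cases h₀ : π 0 < π (Fin.rev 0)
  · exact .inl (hG.eq_of_iso hG' π fun i j hij h => (key i j hij h).2 h₀)
  · refine .inr (hG.intervalClique_reversal.eq_of_iso hG' ((reversalIso G).trans π)
      fun i j hij h => ?_)
    have hr : j.rev < i.rev := Fin.rev_lt_rev.2 hij
    have hk := mt (key j.rev i.rev hr fun h' => h h'.symm).1 h₀
    exact (not_lt.1 hk).lt_of_ne (π.injective.ne hr.ne')

theorem setOf_iso_eq_pair (hG : IntervalClique G) (hc : G.Connected) :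
    {G' : SimpleGraph (Fin n) | IntervalClique G' ∧ Nonempty (G ≃g G')} = {G, reversal G} := by
  ext G'
  simp only [Set.mem_ofPred_eq, Set.mem_insert_iff, Set.mem_singleton_iff]
  constructor
  · rintro ⟨hG', ⟨π⟩⟩
    exact hG.eq_or_eq_reversal hc hG' π
  · rintro (rfl | rfl)
    · exact ⟨hG, ⟨SimpleGraph.Iso.refl⟩⟩
    · exact ⟨hG.intervalClique_reversal, ⟨(reversalIso G).symm⟩⟩

end IntervalClique

/-- for a connected structure of the 1D RGG model, represented by a
connected interval-clique (ordered geometric) graph `G`, the number of ordered geometric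
graphs representing the same structure is `1` if the structure admits a left-right
symmetric representative and `2` otherwise; in particular it is between `1` and `2`. -/
theorem card_ordered_representatives (n : ℕ) (G : SimpleGraph (Fin n))
    (hG : IntervalClique G) (hc : G.Connected) :
    ((∀ i j : Fin n, G.Adj i j ↔ G.Adj i.rev j.rev) →
        {G' : SimpleGraph (Fin n) | IntervalClique G' ∧ Nonempty (G ≃g G')}.ncard = 1) ∧
    (¬ (∀ i j : Fin n, G.Adj i j ↔ G.Adj i.rev j.rev) →
        {G' : SimpleGraph (Fin n) | IntervalClique G' ∧ Nonempty (G ≃g G')}.ncard = 2) ∧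
    1 ≤ {G' : SimpleGraph (Fin n) | IntervalClique G' ∧ Nonempty (G ≃g G')}.ncard ∧
    {G' : SimpleGraph (Fin n) | IntervalClique G' ∧ Nonempty (G ≃g G')}.ncard ≤ 2 := by
  rw [hG.setOf_iso_eq_pair hc, ← IntervalClique.reversal_eq_iff]
  by_cases h : IntervalClique.reversal G = G
  · simp [h]
  · simp [h, Set.ncard_pair (Ne.symm h)]
end

section
/- Let X_1,...,X_n be i.i.d. uniform on [0,1] with order statistics X_(1) ≤ ... ≤ X_(n). For r < 1/2, 2 ≤ i ≤ n−1, and 0 ≤ a ≤ i−2, the probability that node i has exactly a leftward neighbors within range r equals C(n,a)·r^a·(1−r)^{n−a}. -/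
open MeasureTheory

/-- The `k`-th order statistic (1-based, `k`-th smallest) of the values `x`. -/
noncomputable def ordStat {n : ℕ} (x : Fin n → ℝ) (k : ℕ) : ℝ :=
  (List.insertionSort (· ≤ ·) (List.ofFn x)).getD (k - 1) 0

/-- `L_i`: the number of leftward neighbours of node `i` (1-based) in the ordered
geometric graph with connection range `r`: indices `j < i` with `X_(i) − X_(j) ≤ r`. -/
noncomputable def Lcount {n : ℕ} (r : ℝ) (x : Fin n → ℝ) (i : ℕ) : ℕ :=
  ((Finset.Ico 1 i).filter (fun j => ordStat x i - ordStat x j ≤ r)).card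

lemma integral_sub_pow_mul_one_sub_pow (r : ℝ) (b c : ℕ) :
    ∫ t in r..1, (t - r) ^ b * (1 - t) ^ c
      = (1 - r) ^ (b + c + 1) * ((b.factorial * c.factorial : ℕ) : ℝ) / ((b + c + 1).factorial : ℝ) := by
  induction b generalizing c with
  | zero =>
    have h : ∫ t in r..1, (1 - t) ^ c = (1 - r) ^ (c + 1) / (c + 1) := by
      rw [intervalIntegral.integral_comp_sub_left (fun u => u ^ c)]
      simp [integral_pow]
    simp only [pow_zero, one_mul, h, zero_add, Nat.factorial_succ, Nat.factorial_zero]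
    have := Nat.factorial_ne_zero c
    push_cast
    field_simp
  | succ b ih =>
    have hI : ∀ p q : ℕ, IntervalIntegrable (fun t : ℝ => (t - r) ^ p * (1 - t) ^ q) volume r 1 :=
      fun p q => Continuous.intervalIntegrable (by fun_prop) _ _
    have hd : ∀ t ∈ Set.uIcc r 1, HasDerivAt (fun t : ℝ => (t - r) ^ (b + 1) * (1 - t) ^ (c + 1))
        ((b + 1) * ((t - r) ^ b * (1 - t) ^ (c + 1))
          - (c + 1) * ((t - r) ^ (b + 1) * (1 - t) ^ c)) t := by
      intro t _
      have h1 := ((hasDerivAt_id t).sub_const r).pow (b + 1)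
      have h2 := ((hasDerivAt_id t).const_sub 1).pow (c + 1)
      refine (h1.mul h2).congr_deriv ?_
      simp
      ring
    have h := intervalIntegral.integral_eq_sub_of_hasDerivAt hd
      (((hI b (c + 1)).const_mul _).sub ((hI (b + 1) c).const_mul _))
    rw [intervalIntegral.integral_sub ((hI b (c + 1)).const_mul _) ((hI (b + 1) c).const_mul _),
      intervalIntegral.integral_const_mul, intervalIntegral.integral_const_mul, ih] at h
    simp only [sub_self, ne_eq, Nat.add_eq_zero_iff, one_ne_zero, and_false, not_false_eq_true,
      zero_pow, mul_zero, zero_mul] at h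
    have hc : (c + 1 : ℝ) ≠ 0 := by positivity
    refine mul_left_cancel₀ hc ?_
    rw [← sub_eq_zero.mp h, show b + (c + 1) + 1 = b + 1 + c + 1 by ring]
    simp only [Nat.factorial_succ b, Nat.factorial_succ c]
    push_cast
    ring

lemma ae_injective_pi (n : ℕ) : ∀ᵐ x : Fin n → ℝ, Function.Injective x := by
  have h : ∀ j k : Fin n, j ≠ k → ∀ᵐ x : Fin n → ℝ, x j ≠ x k := by
    intro j k hjk
    have h0 := Measure.addHaar_submodule (volume : Measure (Fin n → ℝ))
      (LinearMap.ker ((LinearMap.proj j : (Fin n → ℝ) →ₗ[ℝ] ℝ) - LinearMap.proj k)) (by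
        intro htop
        have hmem : (Pi.single j 1 : Fin n → ℝ) ∈ (⊤ : Submodule ℝ (Fin n → ℝ)) := trivial
        rw [← htop] at hmem
        rw [LinearMap.mem_ker, LinearMap.sub_apply] at hmem
        simp [hjk.symm] at hmem)
    rw [ae_iff]
    convert h0 using 2
    ext x
    simpa using sub_eq_zero.symm
  filter_upwards [ae_all_iff.2 fun j => ae_all_iff.2 fun k =>
    ae_all_iff.2 fun hjk : j ≠ k => h j k hjk] with x hx j k hxjk
  by_contra hne
  exact hx j k hne hxjk

lemma ordStat_eq_sort {n : ℕ} (x : Fin n → ℝ) (p : Fin n) :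
    ordStat x (p + 1) = x (Tuple.sort x p) := by
  have h : List.insertionSort (· ≤ ·) (List.ofFn x) = List.ofFn (x ∘ Tuple.sort x) := by
    refine List.Perm.eq_of_pairwise' (r := (· ≤ ·)) ?_ ?_ ?_
    · exact List.pairwise_insertionSort _ _
    · exact (Tuple.monotone_sort x).sortedLE_ofFn.pairwise
    · exact (List.perm_insertionSort _ _).trans (Equiv.Perm.ofFn_comp_perm _ _).symm
  simp [ordStat, h]

lemma card_filter_pi (m a b : ℕ) {α : Type*} [MeasurableSpace α] (ν : Measure α) [SigmaFinite ν]
    {A B : Set α} [DecidablePred (· ∈ A)] [DecidablePred (· ∈ B)]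
    (hA : MeasurableSet A) (hB : MeasurableSet B) (hAB : Disjoint A B) :
    Measure.pi (fun _ : Fin m => ν) {y | (Finset.univ.filter fun j => y j ∈ A).card = a ∧
        (Finset.univ.filter fun j => y j ∈ B).card = b}
      = (m.choose a * (m - a).choose b : ℕ) *
        (ν A ^ a * ν B ^ b * ν (A ∪ B)ᶜ ^ (m - a - b)) := by
  classical
  set I : Finset ((_ : Finset (Fin m)) × Finset (Fin m)) :=
    (Finset.powersetCard a Finset.univ).sigma fun S => Finset.powersetCard b Sᶜ with hI
  set D : ((_ : Finset (Fin m)) × Finset (Fin m)) → Fin m → Set α :=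
    fun p j => if j ∈ p.1 then A else if j ∈ p.2 then B else (A ∪ B)ᶜ with hD
  have hmem : ∀ y : Fin m → α, ∀ p ∈ I, y ∈ Set.univ.pi (D p) →
      (Finset.univ.filter fun j => y j ∈ A) = p.1 ∧
      (Finset.univ.filter fun j => y j ∈ B) = p.2 := by
    rintro y ⟨S, T⟩ hp hy
    simp only [hI, Finset.mem_sigma, Finset.mem_powersetCard] at hp
    have hST : ∀ j ∈ T, j ∉ S := fun j hj => by simpa using hp.2.1 hj
    have hdis : ∀ z, z ∈ A → z ∉ B := fun _ h => Set.disjoint_left.1 hAB h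
    constructor <;> ext j <;> have hj := hy j trivial <;> have h1 := hST j <;> have h2 := hdis (y j) <;>
      simp only [hD] at hj <;> simp only [Finset.mem_filter, Finset.mem_univ, true_and] <;>
      split_ifs at hj <;> clear hy hp hST hdis hD hI  <;>
      (try simp only [Set.mem_compl_iff, Set.mem_union, not_or] at hj) <;> tauto
  have hset : {y : Fin m → α | (Finset.univ.filter fun j => y j ∈ A).card = a ∧
        (Finset.univ.filter fun j => y j ∈ B).card = b} = ⋃ p ∈ I, Set.univ.pi (D p) := by
    ext y
    simp only [Set.mem_ofPred_eq, Set.mem_iUnion, exists_prop]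
    constructor
    · rintro ⟨h1, h2⟩
      refine ⟨⟨_, _⟩, Finset.mem_sigma.2 ⟨Finset.mem_powersetCard.2 ⟨Finset.subset_univ _, h1⟩,
        Finset.mem_powersetCard.2 ⟨?_, h2⟩⟩, ?_⟩
      · intro j hj
        have hj' : y j ∈ B := by simpa using hj
        simpa using Set.disjoint_right.1 hAB hj'
      · intro j _
        by_cases hjA : y j ∈ A <;> by_cases hjB : y j ∈ B <;> simp [hD, hjA, hjB]
    · rintro ⟨p, hp, hy⟩
      obtain ⟨h1, h2⟩ := hmem y p hp hy
      simp only [hI, Finset.mem_sigma, Finset.mem_powersetCard] at hp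
      rw [h1, h2]
      exact ⟨hp.1.2, hp.2.2⟩
  rw [hset, measure_biUnion_finset]
  · have hval : ∀ p ∈ I, Measure.pi (fun _ : Fin m => ν) (Set.univ.pi (D p))
        = ν A ^ a * ν B ^ b * ν (A ∪ B)ᶜ ^ (m - a - b) := by
      rintro ⟨S, T⟩ hp
      simp only [hI, Finset.mem_sigma, Finset.mem_powersetCard] at hp
      obtain ⟨⟨-, hS⟩, hTS, hT⟩ := hp
      have hdisj : Disjoint S T := Finset.disjoint_left.2 fun j h h' => by
        simpa [h] using hTS h'
      have hf : ∀ j, ν (D ⟨S, T⟩ j)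
          = if j ∈ S then ν A else if j ∈ T then ν B else ν (A ∪ B)ᶜ := by
        intro j; simp only [hD]; split_ifs <;> rfl
      have hfT : (Sᶜ.filter (· ∈ T)) = T := by
        ext j; simp only [Finset.mem_filter]; exact ⟨fun h => h.2, fun h => ⟨hTS h, h⟩⟩
      have hfc : (Sᶜ.filter (· ∉ T)) = Sᶜ \ T := by
        ext j; simp
      have hcc : (Sᶜ \ T).card = m - a - b := by
        rw [Finset.card_sdiff_of_subset hTS, Finset.card_compl, hS, hT, Fintype.card_fin]
      rw [Measure.pi_pi, Finset.prod_congr rfl fun j _ => hf j, Finset.prod_ite, Finset.prod_ite]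
      have e1 : (Finset.univ.filter (· ∈ S)) = S := by simp
      have e2 : (Finset.univ.filter (· ∉ S)) = Sᶜ := by ext; simp
      rw [e1, e2, hfT, hfc]
      simp [hS, hT, hcc, mul_assoc]
    rw [Finset.sum_congr rfl hval, Finset.sum_const, nsmul_eq_mul]
    congr 2
    rw [hI, Finset.card_sigma, Finset.sum_congr rfl (g := fun _ => (m - a).choose b)]
    · simp
    · intro S hS
      rw [Finset.card_powersetCard, Finset.card_compl, (Finset.mem_powersetCard.1 hS).2,
        Fintype.card_fin]
  · intro p hp q hq hpq
    refine Set.disjoint_left.2 fun y h h' => hpq ?_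
    obtain ⟨h1, h2⟩ := hmem y p hp h
    obtain ⟨h3, h4⟩ := hmem y q hq h'
    exact Sigma.ext (h1.symm.trans h3) (heq_of_eq (h2.symm.trans h4))
  · intro p _
    refine MeasurableSet.univ_pi fun j => ?_
    simp only [hD]
    split_ifs
    exacts [hA, hB, (hA.union hB).compl]

lemma card_filter_lt_sort {n : ℕ} {x : Fin n → ℝ} (hx : Function.Injective x) (q : Fin n) :
    (Finset.univ.filter fun j => x j < x (Tuple.sort x q)).card = q := by
  have hmono : StrictMono (x ∘ Tuple.sort x) :=
    (Tuple.monotone_sort x).strictMono_of_injective (hx.comp (Tuple.sort x).injective)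
  have h : (Finset.univ.filter fun j => x j < x (Tuple.sort x q))
      = (Finset.Iio q).map (Tuple.sort x).toEmbedding := by
    ext j
    obtain ⟨p, rfl⟩ := (Tuple.sort x).surjective j
    have := hmono.lt_iff_lt (a := p) (b := q)
    simpa using this
  rw [h, Finset.card_map, Fin.card_Iio]

lemma Lcount_eq_card {n : ℕ} (r : ℝ) {x : Fin n → ℝ} (hx : Function.Injective x) (q : Fin n) :
    Lcount r x (q + 1) = (Finset.univ.filter fun j =>
      x j ∈ Set.Ico (x (Tuple.sort x q) - r) (x (Tuple.sort x q))).card := by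
  have hmono : StrictMono (x ∘ Tuple.sort x) :=
    (Tuple.monotone_sort x).strictMono_of_injective (hx.comp (Tuple.sort x).injective)
  symm
  refine Finset.card_nbij (fun j => ((Tuple.sort x).symm j : ℕ) + 1) ?_ ?_ ?_
  · intro j hj
    obtain ⟨p, rfl⟩ := (Tuple.sort x).surjective j
    simp only [Finset.coe_filter, Finset.mem_univ, true_and, Set.mem_ofPred_eq, Set.mem_Ico] at hj
    have hpq : p < q := hmono.lt_iff_lt.1 hj.2
    have hpq' : (p : ℕ) < q := hpq
    simp only [Finset.coe_filter, Set.mem_ofPred_eq, Equiv.symm_apply_apply, Finset.mem_Ico,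
      ordStat_eq_sort]
    exact ⟨by omega, by linarith⟩
  · intro j _ k _ h
    simpa [Fin.val_inj] using h
  · intro p hp
    simp only [Finset.coe_filter, Finset.mem_Ico, Set.mem_ofPred_eq] at hp
    obtain ⟨⟨h1, h2⟩, h3⟩ := hp
    obtain ⟨p, rfl⟩ := Nat.exists_eq_add_of_le' h1
    have hpq : (⟨p, by omega⟩ : Fin n) < q := Fin.lt_def.2 (by simpa using h2)
    rw [ordStat_eq_sort, ordStat_eq_sort x ⟨p, by omega⟩] at h3
    refine ⟨Tuple.sort x ⟨p, by omega⟩, ?_, by simp⟩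
    have := hmono hpq
    simp only [Function.comp_apply] at this
    simp only [Finset.coe_filter, Finset.mem_univ, true_and, Set.mem_ofPred_eq, Set.mem_Ico]
    exact ⟨by linarith, this⟩

lemma card_filter_lt_eq_add {n : ℕ} {r : ℝ} (hr : 0 ≤ r) (x : Fin n → ℝ) (t : ℝ) :
    (Finset.univ.filter fun j => x j < t).card
      = (Finset.univ.filter fun j => x j ∈ Set.Ico (t - r) t).card
        + (Finset.univ.filter fun j => x j ∈ Set.Iio (t - r)).card := by
  rw [← Finset.card_union_of_disjoint]
  · congr 1
    ext j
    simp only [Finset.mem_filter, Finset.mem_univ, true_and, Finset.mem_union, Set.mem_Ico,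
      Set.mem_Iio]
    constructor
    · intro h
      by_cases h' : x j < t - r
      · exact Or.inr h'
      · exact Or.inl ⟨not_lt.1 h', h⟩
    · rintro (h | h)
      · exact h.2
      · linarith
  · rw [Finset.disjoint_filter]
    intro j _ h h'
    exact absurd h.1 (not_le.2 h')

/-- The `k`-th coordinate has exactly `a` others at distance at most `r` on its left, and exactly
`b` others further to the left. -/
def leftCountEvent (n : ℕ) (r : ℝ) (a b : ℕ) (k : Fin n) : Set (Fin n → ℝ) :=
  {x | (Finset.univ.filter fun j => x j ∈ Set.Ico (x k - r) (x k)).card = a ∧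
    (Finset.univ.filter fun j => x j ∈ Set.Iio (x k - r)).card = b}

lemma eq_sort_of_mem_leftCountEvent {n : ℕ} {r : ℝ} (hr : 0 ≤ r) {a b : ℕ} {x : Fin n → ℝ}
    (hx : Function.Injective x) {q k : Fin n} (hq : a + b = q)
    (h : x ∈ leftCountEvent n r a b k) : k = Tuple.sort x q := by
  obtain ⟨p, rfl⟩ := (Tuple.sort x).surjective k
  have h1 := card_filter_lt_eq_add hr x (x (Tuple.sort x p))
  rw [card_filter_lt_sort hx, h.1, h.2, hq] at h1
  rw [Fin.ext h1]

lemma Lcount_eq_iff {n : ℕ} {r : ℝ} (hr : 0 ≤ r) {a b : ℕ} {x : Fin n → ℝ}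
    (hx : Function.Injective x) {q : Fin n} (hq : a + b = q) :
    Lcount r x (q + 1) = a ↔ ∃ k, x ∈ leftCountEvent n r a b k := by
  rw [Lcount_eq_card r hx]
  constructor
  · intro h
    refine ⟨Tuple.sort x q, h, ?_⟩
    have h1 := card_filter_lt_eq_add hr x (x (Tuple.sort x q))
    rw [card_filter_lt_sort hx, h] at h1
    omega
  · rintro ⟨k, hk⟩
    rw [← eq_sort_of_mem_leftCountEvent hr hx hq hk]
    exact hk.1

lemma measurableSet_card_filter {Ω : Type*} [MeasurableSpace Ω] {n : ℕ} (p : Fin n → Ω → Prop)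
    [∀ j x, Decidable (p j x)] (hp : ∀ j, MeasurableSet {x | p j x}) (a : ℕ) :
    MeasurableSet {x | (Finset.univ.filter fun j => p j x).card = a} := by
  simp only [Finset.card_filter]
  refine measurableSet_eq_fun (Finset.measurable_sum _ fun j _ => ?_) measurable_const
  exact Measurable.ite (hp j) measurable_const measurable_const

/-- Given a distinguished value `t`, exactly `a` of the coordinates of `y` lie in `[t - r, t)`
and exactly `b` lie below `t - r`. -/
def pairCountEvent (m : ℕ) (r : ℝ) (a b : ℕ) : Set (ℝ × (Fin m → ℝ)) :=
  {z | (Finset.univ.filter fun j => z.2 j ∈ Set.Ico (z.1 - r) z.1).card = a ∧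
    (Finset.univ.filter fun j => z.2 j ∈ Set.Iio (z.1 - r)).card = b}

lemma measurableSet_pairCountEvent (m : ℕ) (r : ℝ) (a b : ℕ) :
    MeasurableSet (pairCountEvent m r a b) := by
  refine MeasurableSet.inter (measurableSet_card_filter (fun j (z : ℝ × (Fin m → ℝ)) =>
    z.2 j ∈ Set.Ico (z.1 - r) z.1) (fun j => ?_) a) (measurableSet_card_filter
    (fun j (z : ℝ × (Fin m → ℝ)) => z.2 j ∈ Set.Iio (z.1 - r)) (fun j => ?_) b)
  · exact (measurableSet_le (f := fun z : ℝ × (Fin m → ℝ) => z.1 - r) (g := fun z => z.2 j)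
      (by fun_prop) (by fun_prop)).inter
        (measurableSet_lt (f := fun z : ℝ × (Fin m → ℝ) => z.2 j) (g := fun z => z.1)
          (by fun_prop) (by fun_prop))
  · exact measurableSet_lt (f := fun z : ℝ × (Fin m → ℝ) => z.2 j) (g := fun z => z.1 - r)
      (by fun_prop) (by fun_prop)

lemma leftCountEvent_eq_preimage {m : ℕ} {r : ℝ} (hr : 0 ≤ r) (a b : ℕ) (k : Fin (m + 1)) :
    leftCountEvent (m + 1) r a b k
      = MeasurableEquiv.piFinSuccAbove (fun _ => ℝ) k ⁻¹' pairCountEvent m r a b := by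
  ext x
  have h1 : ¬ x k ∈ Set.Ico (x k - r) (x k) := fun h => lt_irrefl _ h.2
  have h2 : ¬ x k ∈ Set.Iio (x k - r) := fun h => by
    have : x k < x k - r := h
    linarith
  simp only [leftCountEvent, pairCountEvent, Set.mem_preimage, Set.mem_ofPred_eq,
    Finset.card_filter, Fin.sum_univ_succAbove _ k, if_neg h1, if_neg h2, zero_add]
  rfl

lemma volume_restrict_Icc_pieces {r t : ℝ} (hr : 0 ≤ r) (ht : t ∈ Set.Icc (0 : ℝ) 1) :
    (volume.restrict (Set.Icc (0 : ℝ) 1)) (Set.Iio (t - r)) = ENNReal.ofReal (t - r) ∧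
    (volume.restrict (Set.Icc (0 : ℝ) 1)) (Set.Ico (t - r) t ∪ Set.Iio (t - r))ᶜ
      = ENNReal.ofReal (1 - t) ∧
    (r ≤ t → (volume.restrict (Set.Icc (0 : ℝ) 1)) (Set.Ico (t - r) t) = ENNReal.ofReal r) := by
  obtain ⟨h0, h1⟩ := ht
  refine ⟨?_, ?_, fun hrt => ?_⟩
  · rw [Measure.restrict_apply measurableSet_Iio,
      show Set.Iio (t - r) ∩ Set.Icc 0 1 = Set.Ico 0 (t - r) by
        ext z; simp only [Set.mem_inter_iff, Set.mem_Iio, Set.mem_Icc, Set.mem_Ico]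
        constructor <;> intro h <;> refine ⟨?_, ?_⟩ <;> grind]
    simp
  · rw [Measure.restrict_apply (by measurability),
      show (Set.Ico (t - r) t ∪ Set.Iio (t - r))ᶜ ∩ Set.Icc 0 1 = Set.Icc t 1 by
        ext z
        simp only [Set.mem_inter_iff, Set.mem_Iio, Set.mem_Icc, Set.mem_Ico, Set.mem_compl_iff,
          Set.mem_union]
        grind]
    simp
  · rw [Measure.restrict_apply measurableSet_Ico,
      show Set.Ico (t - r) t ∩ Set.Icc 0 1 = Set.Ico (t - r) t by
        ext z; simp only [Set.mem_inter_iff, Set.mem_Icc, Set.mem_Ico]; grind]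
    simp

lemma prod_pairCountEvent {r : ℝ} (hr0 : 0 < r) (hr1 : r ≤ 1) {a b c : ℕ} (hb : b ≠ 0) :
    ((volume.restrict (Set.Icc (0 : ℝ) 1)).prod
        (Measure.pi fun _ : Fin (a + b + c) => volume.restrict (Set.Icc (0 : ℝ) 1)))
        (pairCountEvent (a + b + c) r a b)
      = ENNReal.ofReal (((a + b + c).choose a * (b + c).choose b : ℕ) * (r ^ a *
          ∫ t in r..1, (t - r) ^ b * (1 - t) ^ c)) := by
  set K : ℕ := (a + b + c).choose a * (b + c).choose b with hK
  set f : ℝ → ℝ := fun t => K * (r ^ a * ((t - r) ^ b * (1 - t) ^ c)) with hf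
  have hslice : ∀ t ∈ Set.Icc (0 : ℝ) 1,
      (Measure.pi fun _ : Fin (a + b + c) => volume.restrict (Set.Icc (0 : ℝ) 1))
        (Prod.mk t ⁻¹' pairCountEvent (a + b + c) r a b)
      = (Set.Ioc r 1).indicator (fun t => ENNReal.ofReal (f t)) t := by
    intro t ht
    have h := card_filter_pi (a + b + c) a b (volume.restrict (Set.Icc (0 : ℝ) 1))
      (measurableSet_Ico (a := t - r) (b := t)) (measurableSet_Iio (a := t - r))
      (Set.disjoint_left.2 fun z hz hz' => absurd hz.1 (not_le.2 hz'))
    obtain ⟨hB, hC, hA⟩ := volume_restrict_Icc_pieces hr0.le ht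
    rw [show a + b + c - a - b = c by omega, show a + b + c - a = b + c by omega, hB, hC,
      ← hK] at h
    refine h.trans ?_
    by_cases hrt : r < t
    · rw [Set.indicator_of_mem (Set.mem_Ioc.2 ⟨hrt, ht.2⟩), hA hrt.le, hf,
        ENNReal.ofReal_mul (by positivity), ENNReal.ofReal_natCast,
        ENNReal.ofReal_mul (by positivity), ENNReal.ofReal_mul (by
          have := sub_pos.2 hrt
          positivity),
        ENNReal.ofReal_pow hr0.le, ENNReal.ofReal_pow (sub_pos.2 hrt).le,
        ENNReal.ofReal_pow (sub_nonneg.2 ht.2), mul_assoc]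
    · rw [Set.indicator_of_notMem (fun h => hrt h.1),
        ENNReal.ofReal_of_nonpos (by linarith : t - r ≤ 0), zero_pow hb]
      simp
  rw [Measure.prod_apply (measurableSet_pairCountEvent _ _ _ _),
    setLIntegral_congr_fun measurableSet_Icc hslice, lintegral_indicator measurableSet_Ioc,
    Measure.restrict_restrict measurableSet_Ioc,
    Set.inter_eq_left.2 (Set.Ioc_subset_Icc_self.trans (Set.Icc_subset_Icc_left hr0.le)),
    ← ofReal_integral_eq_lintegral_ofReal]
  · rw [← intervalIntegral.integral_of_le hr1, hf, intervalIntegral.integral_const_mul,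
      intervalIntegral.integral_const_mul]
  · exact (Continuous.integrableOn_Ioc (by fun_prop))
  · refine (ae_restrict_iff' measurableSet_Ioc).2 (Filter.Eventually.of_forall fun t ht => ?_)
    have h1 := sub_pos.2 ht.1
    have h2 := sub_nonneg.2 ht.2
    simp only [hf, Pi.zero_apply]
    positivity

lemma succ_mul_choose_mul_choose (a b c : ℕ) :
    (a + b + c + 1) * ((a + b + c).choose a * (b + c).choose b) * (b.factorial * c.factorial)
      = (a + b + c + 1).choose a * (b + c + 1).factorial := by
  have h1 := Nat.add_choose_mul_factorial_mul_factorial b c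
  have h2 := Nat.add_choose_mul_factorial_mul_factorial a (b + c)
  have h3 := Nat.add_choose_mul_factorial_mul_factorial a (b + c + 1)
  rw [← Nat.choose_symm_add] at h1 h2 h3
  rw [← add_assoc] at h2
  rw [show a + (b + c + 1) = a + b + c + 1 by ring, Nat.factorial_succ (a + b + c)] at h3
  refine Nat.eq_of_mul_eq_mul_right (Nat.factorial_pos a) ?_
  calc _ = (a + b + c + 1) * ((a + b + c).choose a * a.factorial *
        ((b + c).choose b * b.factorial * c.factorial)) := by ring
    _ = (a + b + c + 1).choose a * a.factorial * (b + c + 1).factorial := by rw [h1, h2, h3]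
    _ = _ := by ring

/-- for i.i.d. uniform points on `[0,1]`, `r < 1/2`, `2 ≤ i ≤ n−1` and
`0 ≤ a ≤ i−2`, the probability that node `i` has exactly `a` leftward neighbours equals
`C(n,a)·r^a·(1−r)^{n−a}`. -/
theorem prob_Li_eq_a (n : ℕ) (r : ℝ) (hr0 : 0 < r) (hr : r < 1 / 2)
    (i a : ℕ) (hi : 2 ≤ i) (hin : i ≤ n - 1) (ha : a + 2 ≤ i) :
    (volume.restrict (Set.univ.pi fun _ : Fin n => Set.Icc (0 : ℝ) 1))
        {x : Fin n → ℝ | Lcount r x i = a}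
      = ENNReal.ofReal ((n.choose a : ℝ) * r ^ a * (1 - r) ^ (n - a)) := by
  obtain ⟨b, rfl⟩ : ∃ b, i = a + b + 1 := ⟨i - a - 1, by omega⟩
  obtain ⟨c, rfl⟩ : ∃ c, n = a + b + c + 1 := ⟨n - a - b - 1, by omega⟩
  have hq : a + b = ((⟨a + b, by omega⟩ : Fin (a + b + c + 1)) : ℕ) := rfl
  have hinj := ae_restrict_of_ae (s := Set.univ.pi fun _ : Fin (a + b + c + 1) => Set.Icc (0 : ℝ) 1)
    (ae_injective_pi (a + b + c + 1))
  rw [volume_pi, Measure.restrict_pi_pi] at *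
  have hmeas : ∀ k, MeasurableSet (leftCountEvent (a + b + c + 1) r a b k) := fun k => by
    rw [leftCountEvent_eq_preimage hr0.le]
    exact (MeasurableEquiv.measurable _) (measurableSet_pairCountEvent _ _ _ _)
  have hevent : {x : Fin (a + b + c + 1) → ℝ | Lcount r x (a + b + 1) = a}
      =ᵐ[Measure.pi fun _ => volume.restrict (Set.Icc (0 : ℝ) 1)]
        ⋃ k, leftCountEvent (a + b + c + 1) r a b k := by
    filter_upwards [hinj] with x hx
    exact propext ((Lcount_eq_iff hr0.le hx hq).trans Set.mem_iUnion.symm)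
  rw [measure_congr hevent, measure_iUnion₀ ?_ fun k => (hmeas k).nullMeasurableSet]
  · have hk : ∀ k, (Measure.pi fun _ => volume.restrict (Set.Icc (0 : ℝ) 1))
        (leftCountEvent (a + b + c + 1) r a b k)
          = ENNReal.ofReal (((a + b + c).choose a * (b + c).choose b : ℕ) * (r ^ a *
            ∫ t in r..1, (t - r) ^ b * (1 - t) ^ c)) := fun k => by
      rw [leftCountEvent_eq_preimage hr0.le,
        (measurePreserving_piFinSuccAbove (fun _ => volume.restrict (Set.Icc (0 : ℝ) 1)) k
          ).measure_preimage_equiv]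
      exact prod_pairCountEvent hr0 (by linarith) (by omega)
    rw [tsum_fintype, Finset.sum_congr rfl fun k _ => hk k, Finset.sum_const, Finset.card_univ,
      Fintype.card_fin, nsmul_eq_mul, ← ENNReal.ofReal_natCast,
      ← ENNReal.ofReal_mul (Nat.cast_nonneg _), integral_sub_pow_mul_one_sub_pow,
      show a + b + c + 1 - a = b + c + 1 by omega]
    congr 1
    have hcomb : (((a + b + c + 1) * ((a + b + c).choose a * (b + c).choose b) *
        (b.factorial * c.factorial) : ℕ) : ℝ)
        = ((a + b + c + 1).choose a * (b + c + 1).factorial : ℕ) :=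
      congrArg _ (succ_mul_choose_mul_choose a b c)
    have hfac : ((b + c + 1).factorial : ℝ) ≠ 0 := by positivity
    field_simp
    push_cast at hcomb ⊢
    linear_combination (1 - r) ^ (b + c + 1) * hcomb
  · intro k l hkl
    refine measure_mono_null (fun x hx => ?_) (ae_iff.1 hinj)
    rw [Set.mem_ofPred_eq]
    refine fun hinjx => hkl ?_
    exact (eq_sort_of_mem_leftCountEvent hr0.le hinjx hq hx.1).trans
      (eq_sort_of_mem_leftCountEvent hr0.le hinjx hq hx.2).symm
end
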